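/- Let n ≥ 1 and α ∈ (−1,1), and define P(y,x) := x^{1−α} (x² + |y|²)^{−(n+1−α)/2} for y ∈ ℝⁿ, x > 0. Then P satisfies div(x^α ∇P) = 0 in ℝ^{n+1}₊; that is, for every (y,x) ∈ ℝⁿ × (0,∞), ∂_x( x^α ∂_x P(y,x) ) + x^α Σ_{j=1}^n ∂²_{y_j y_j} P(y,x) = 0, all derivatives being classical. -/

import Mathlib

open MeasureTheory Metric Set
open scoped Topology

noncomputable section

/-- The (unnormalized) Poisson kernel
`P(y,x) = x^{1−α} (x² + |y|²)^{−(n+1−α)/2}` of the operator `div(x^α ∇·)`. -/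
def P (n : ℕ) (α : ℝ) (y : EuclideanSpace ℝ (Fin n)) (x : ℝ) : ℝ :=
  x ^ (1 - α) * (x ^ 2 + ‖y‖ ^ 2) ^ (-(((n : ℝ) + 1 - α) / 2))

/-- The normalizing constant `c_{n,α}`. -/
def cnα (n : ℕ) (α : ℝ) : ℝ :=
  (∫ y : EuclideanSpace ℝ (Fin n), (1 + ‖y‖ ^ 2) ^ (-(((n : ℝ) + 1 - α) / 2)))⁻¹

theorem hasFDerivAt_sq_add_norm_sq_rpow {E : Type*} [NormedAddCommGroup E]
    [InnerProductSpace ℝ E] (y : E) {x : ℝ} (hx : 0 < x) (s : ℝ) :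
    HasFDerivAt (fun z : E => (x ^ 2 + ‖z‖ ^ 2) ^ s)
      ((s * (x ^ 2 + ‖y‖ ^ 2) ^ (s - 1)) • (2 • innerSL ℝ y)) y := by
  have h : x ^ 2 + ‖y‖ ^ 2 ≠ 0 := by positivity
  exact (((hasStrictFDerivAt_norm_sq y).hasFDerivAt).const_add (x ^ 2)).rpow_const (Or.inl h)

theorem hasDerivAt_sq_add_rpow {x c : ℝ} (hx : 0 < x) (hc : 0 ≤ c) (s : ℝ) :
    HasDerivAt (fun t : ℝ => (t ^ 2 + c) ^ s) (2 * s * x * (x ^ 2 + c) ^ (s - 1)) x := by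
  have h : x ^ 2 + c ≠ 0 := by positivity
  convert ((hasDerivAt_pow 2 x).add_const c).rpow_const (p := s) (Or.inl h) using 1
  push_cast
  ring

/-- The weighted normal derivative `x^α ∂ₓP`. -/
theorem rpow_mul_deriv_P (n : ℕ) (α : ℝ) (y : EuclideanSpace ℝ (Fin n)) {s : ℝ}
    (hs : s = -(((n : ℝ) + 1 - α) / 2)) {x : ℝ} (hx : 0 < x) :
    x ^ α * deriv (fun t : ℝ => P n α y t) x =
      (1 - α) * (x ^ 2 + ‖y‖ ^ 2) ^ s + 2 * s * x ^ 2 * (x ^ 2 + ‖y‖ ^ 2) ^ (s - 1) := by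
  have h := (Real.hasDerivAt_rpow_const (p := 1 - α) (Or.inl hx.ne')).mul
    (hasDerivAt_sq_add_rpow hx (sq_nonneg ‖y‖) s)
  have hP : (fun t : ℝ => P n α y t) =
      (fun t : ℝ => t ^ (1 - α)) * fun t : ℝ => (t ^ 2 + ‖y‖ ^ 2) ^ s := by
    funext t
    simp [P, hs]
  rw [hP, h.deriv]
  have h₀ : x ^ α * x ^ (1 - α - 1) = 1 := by
    rw [← Real.rpow_add hx]
    simp
  have h₁ : x ^ α * x ^ (1 - α) = x := by
    rw [← Real.rpow_add hx]
    simp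
  linear_combination (1 - α) * (x ^ 2 + ‖y‖ ^ 2) ^ s * h₀ +
    2 * s * x * (x ^ 2 + ‖y‖ ^ 2) ^ (s - 1) * h₁

/-- The first tangential derivatives `∂_{y_j} P`. -/
theorem fderiv_P_single (n : ℕ) (α : ℝ) (y : EuclideanSpace ℝ (Fin n)) {s : ℝ}
    (hs : s = -(((n : ℝ) + 1 - α) / 2)) {x : ℝ} (hx : 0 < x) (j : Fin n) :
    fderiv ℝ (fun z => P n α z x) y (EuclideanSpace.single j 1) =
      x ^ (1 - α) * (2 * s) * (y j * (x ^ 2 + ‖y‖ ^ 2) ^ (s - 1)) := by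
  have h := (hasFDerivAt_sq_add_norm_sq_rpow y hx s).const_mul (x ^ (1 - α))
  have hP : (fun z => P n α z x) = fun z => x ^ (1 - α) * (x ^ 2 + ‖z‖ ^ 2) ^ s := by
    funext z
    simp [P, hs]
  rw [hP, h.fderiv]
  simp [EuclideanSpace.inner_single_right]
  ring

/-- The second tangential derivatives `∂²_{y_j y_j} P`. -/
theorem fderiv_fderiv_P_single (n : ℕ) (α : ℝ) (y : EuclideanSpace ℝ (Fin n)) {s : ℝ}
    (hs : s = -(((n : ℝ) + 1 - α) / 2)) {x : ℝ} (hx : 0 < x) (j : Fin n) :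
    fderiv ℝ (fun z => fderiv ℝ (fun w => P n α w x) z (EuclideanSpace.single j 1))
        y (EuclideanSpace.single j 1) =
      x ^ (1 - α) * (2 * s) * ((x ^ 2 + ‖y‖ ^ 2) ^ (s - 1) +
        2 * (s - 1) * (x ^ 2 + ‖y‖ ^ 2) ^ (s - 2) * y j ^ 2) := by
  have hcoord : HasFDerivAt (fun z : EuclideanSpace ℝ (Fin n) => z j)
      (EuclideanSpace.proj j : EuclideanSpace ℝ (Fin n) →L[ℝ] ℝ) y :=
    (EuclideanSpace.proj j : EuclideanSpace ℝ (Fin n) →L[ℝ] ℝ).hasFDerivAt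
  have h := (hcoord.mul (hasFDerivAt_sq_add_norm_sq_rpow y hx (s - 1))).const_mul
    (x ^ (1 - α) * (2 * s))
  rw [funext fun z => fderiv_P_single n α z hs hx j]
  erw [h.fderiv]
  simp [EuclideanSpace.inner_single_right, show s - 1 - 1 = s - 2 by ring]
  ring

/-- Lemma 4.1 (from Caffarelli--Silvestre): the Poisson kernel `P` satisfies
`div(x^α ∇P) = 0` in `ℝ^{n+1}_+`, i.e. `∂ₓ(x^α ∂ₓP) + x^α Σ_j ∂²_{y_jy_j} P = 0`,
all derivatives being classical. -/
theorem poisson_kernel_harmonic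
    (n : ℕ) (hn : 1 ≤ n) (α : ℝ) (hα : α ∈ Ioo (-1:ℝ) 1)
    (y : EuclideanSpace ℝ (Fin n)) (x : ℝ) (hx : 0 < x) :
    deriv (fun t : ℝ => t ^ α * deriv (fun t' : ℝ => P n α y t') t) x +
      x ^ α * ∑ j : Fin n,
        fderiv ℝ (fun y' => fderiv ℝ (fun y'' => P n α y'' x) y' (EuclideanSpace.single j 1))
          y (EuclideanSpace.single j 1) = 0 := by
  obtain ⟨s, hs⟩ : ∃ s : ℝ, s = -(((n : ℝ) + 1 - α) / 2) := ⟨_, rfl⟩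
  have hr : 0 < x ^ 2 + ‖y‖ ^ 2 := by positivity
  have hnormal : (fun t : ℝ => t ^ α * deriv (fun t' : ℝ => P n α y t') t) =ᶠ[𝓝 x]
      fun t => (1 - α) * (t ^ 2 + ‖y‖ ^ 2) ^ s +
        2 * s * (t ^ 2 * (t ^ 2 + ‖y‖ ^ 2) ^ (s - 1)) := by
    filter_upwards [lt_mem_nhds hx] with t ht
    rw [rpow_mul_deriv_P n α y hs ht]
    ring
  have hderiv := ((hasDerivAt_sq_add_rpow hx (sq_nonneg ‖y‖) s).const_mul (1 - α)).add
    (((hasDerivAt_pow 2 x).mul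
      (hasDerivAt_sq_add_rpow hx (sq_nonneg ‖y‖) (s - 1))).const_mul (2 * s))
  have hsum : ∑ j : Fin n, y j ^ 2 = ‖y‖ ^ 2 := (EuclideanSpace.real_norm_sq_eq y).symm
  have hx₁ : x ^ α * x ^ (1 - α) = x := by
    rw [← Real.rpow_add hx]
    simp
  have hr₁ : (x ^ 2 + ‖y‖ ^ 2) ^ (s - 1) =
      (x ^ 2 + ‖y‖ ^ 2) ^ (s - 2) * (x ^ 2 + ‖y‖ ^ 2) := by
    rw [← Real.rpow_add_one hr.ne']
    ring_nf
  rw [hnormal.deriv_eq]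
  erw [hderiv.deriv]
  simp_rw [fderiv_fderiv_P_single n α y hs hx]
  rw [← Finset.mul_sum, Finset.sum_add_distrib, ← Finset.mul_sum, hsum, ← mul_assoc (x ^ α),
    ← mul_assoc (x ^ α), hx₁, show s - 1 - 1 = s - 2 by ring, hr₁]
  simp only [Finset.sum_const, Finset.card_univ, Fintype.card_fin, nsmul_eq_mul]
  have hn' : (n : ℝ) = α - 1 - 2 * s := by linarith
  rw [hn']
  push_cast
  ring
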